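/- Let N ≥ 4 be an integer, k > 1/2 real, and for each nontrivial zero ρ of the Riemann zeta function set Z_N(w) = ∑_ρ Γ(ρ) N^ρ / Γ(ρ + w + 1). Then the double sum ∑_ρ ∑_{ρ'} Γ(ρ)Γ(ρ') N^{ρ+ρ'} / Γ(ρ + ρ' + k + 1) converges absolutely and equals ∑_ρ Γ(ρ) Z_N(ρ + k) N^ρ. -/

import Mathlib

section
open Complex Set MeasureTheory

lemma mellin_strip_bound (f : ℝ → ℂ) (hc : ∀ s : ℂ, MellinConvergent f s) (a b : ℝ) :
    ∃ B, ∀ s : ℂ, a ≤ s.re → s.re ≤ b → ‖mellin f s‖ ≤ B := by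
  have key : ∀ s : ℂ, IntegrableOn (fun x : ℝ => x ^ (s.re - 1) * ‖f x‖) (Ioi 0) := by
    intro s
    have h := (hc s).norm
    refine h.congr ?_
    filter_upwards [ae_restrict_mem measurableSet_Ioi] with x hx
    rw [norm_smul, Complex.norm_cpow_eq_rpow_re_of_pos hx]
    simp
  have ka := key (a : ℂ)
  have kb := key (b : ℂ)
  simp only [ofReal_re] at ka kb
  refine ⟨∫ x in Ioi (0:ℝ), (x ^ (a - 1) * ‖f x‖ + x ^ (b - 1) * ‖f x‖), fun s h1 h2 => ?_⟩
  unfold mellin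
  refine norm_integral_le_of_norm_le (ka.add kb) ?_
  filter_upwards [ae_restrict_mem measurableSet_Ioi] with x hx
  rw [norm_smul, Complex.norm_cpow_eq_rpow_re_of_pos hx]
  have hx' : (0:ℝ) < x := hx
  have : x ^ (s - 1).re ≤ x ^ (a-1) + x ^ (b-1) := by
    have e1 : 0 < x ^ (a-1) := by positivity
    have e2 : 0 < x ^ (b-1) := by positivity
    rcases le_total x 1 with h | h
    · have := Real.rpow_le_rpow_of_exponent_ge hx' h (show a - 1 ≤ (s-1).re by simpa using h1)
      linarith
    · have := Real.rpow_le_rpow_of_exponent_le h (show (s-1).re ≤ b - 1 by simpa using h2)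
      linarith
  show _ ≤ x ^ (a-1) * ‖f x‖ + x ^ (b-1) * ‖f x‖
  rw [← add_mul]
  gcongr

lemma xi0_strip_bound (a b : ℝ) :
    ∃ B, ∀ s : ℂ, a ≤ s.re → s.re ≤ b → ‖completedRiemannZeta₀ s‖ ≤ B := by
  have hc : ∀ s : ℂ, MellinConvergent (HurwitzZeta.hurwitzEvenFEPair 0).f_modif s := fun s =>
    ((HurwitzZeta.hurwitzEvenFEPair 0).isStrongFEPair_toStrongFEPair.hasMellin s).1
  obtain ⟨B, hB⟩ := mellin_strip_bound _ hc (a/2) (b/2)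
  refine ⟨B/2, fun s h1 h2 => ?_⟩
  have : completedRiemannZeta₀ s = mellin (HurwitzZeta.hurwitzEvenFEPair 0).f_modif (s/2) / 2 := rfl
  rw [this, norm_div]
  have hr : (s/2).re = s.re/2 := by simp
  have := hB (s/2) (by rw [hr]; linarith) (by rw [hr]; linarith)
  simp only [RCLike.norm_ofNat]
  linarith

lemma norm_Gamma_le_real {s : ℂ} (hs : 0 < s.re) : ‖Complex.Gamma s‖ ≤ Real.Gamma s.re := by
  rw [Complex.Gamma_eq_integral hs, Real.Gamma_eq_integral hs, Complex.GammaIntegral]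
  refine norm_integral_le_of_norm_le (Real.GammaIntegral_convergent hs) ?_
  filter_upwards [ae_restrict_mem measurableSet_Ioi] with x hx
  rw [norm_mul, Complex.norm_cpow_eq_rpow_re_of_pos hx, Complex.norm_real,
    Real.norm_of_nonneg (Real.exp_pos _).le]
  simp

lemma norm_zeta_bound : ∃ B, ∀ s : ℂ, 2 ≤ s.re → ‖riemannZeta s‖ ≤ B := by
  have hsum : Summable (fun n : ℕ => 1 / (n:ℝ) ^ (2:ℝ)) :=
    Real.summable_one_div_nat_rpow.2 (by norm_num)
  refine ⟨∑' n : ℕ, 1 / (n:ℝ) ^ (2:ℝ), fun s hs => ?_⟩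
  rw [zeta_eq_tsum_one_div_nat_cpow (by linarith)]
  refine tsum_of_norm_bounded hsum.hasSum fun n => ?_
  rcases Nat.eq_zero_or_pos n with rfl | hn
  · have : s ≠ 0 := by rintro rfl; norm_num at hs
    simp [this]
  · rw [norm_div, norm_one, Complex.norm_natCast_cpow_of_pos hn]
    have : (1:ℝ) ≤ n := by exact_mod_cast hn
    gcongr

lemma xi0_right_bound : ∃ B, 0 ≤ B ∧ ∀ s : ℂ, 1/2 ≤ s.re → 
    ‖completedRiemannZeta₀ s‖ ≤ B * (‖s‖ + 1) ^ (‖s‖ + 1) := by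
  obtain ⟨B1, h1⟩ := xi0_strip_bound (1/2) 4
  obtain ⟨B2, h2⟩ := norm_zeta_bound
  have hB1 : 0 ≤ B1 := (norm_nonneg _).trans (h1 1 (by norm_num) (by norm_num))
  have hB2 : 0 ≤ B2 := (norm_nonneg _).trans (h2 2 (by norm_num))
  refine ⟨B1 + B2 + 2, by positivity, fun s hs => ?_⟩
  have hone : 1 ≤ (‖s‖ + 1) ^ (‖s‖ + 1) := Real.one_le_rpow (by linarith [norm_nonneg s]) (by positivity)
  rcases le_total s.re 4 with h | h
  · have := h1 s hs h
    nlinarith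
  have hs0 : s ≠ 0 := by rintro rfl; norm_num at h
  have hs1 : 1 - s ≠ 0 := by
    intro h0
    have := congrArg Complex.re h0
    simp at this; linarith
  have hn : s.re ≤ ‖s‖ := Complex.re_le_norm s
  have hG : s.Gammaℝ ≠ 0 := Complex.Gammaℝ_ne_zero_of_re_pos (by linarith)
  have e1 : completedRiemannZeta₀ s = riemannZeta s * s.Gammaℝ + 1 / s + 1 / (1 - s) := by
    rw [riemannZeta_def_of_ne_zero hs0, div_mul_cancel₀ _ hG, completedRiemannZeta_eq]; ring
  have e2 : ‖(1:ℂ) / s‖ ≤ 1 := by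
    rw [norm_div, norm_one]; apply div_le_one_of_le₀ <;> linarith [norm_nonneg s]
  have e3 : ‖(1:ℂ) / (1 - s)‖ ≤ 1 := by
    rw [norm_div, norm_one]
    have : (s-1).re ≤ ‖s - 1‖ := Complex.re_le_norm _
    rw [norm_sub_rev] at this
    simp at this
    apply div_le_one_of_le₀ <;> linarith [norm_nonneg s]
  have e4 : ‖s.Gammaℝ‖ ≤ (‖s‖ + 1) ^ (‖s‖ + 1) := by
    rw [Complex.Gammaℝ_def, norm_mul, Complex.norm_cpow_eq_rpow_re_of_pos Real.pi_pos]
    have hr : (s/2).re = s.re/2 := by simp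
    have f1 : Real.pi ^ (-s/2).re ≤ 1 := by
      apply Real.rpow_le_one_of_one_le_of_nonpos
      · linarith [Real.pi_gt_three]
      · simp; linarith
    have f2 : ‖Complex.Gamma (s/2)‖ ≤ (‖s‖ + 1) ^ (‖s‖ + 1) := by
      refine (norm_Gamma_le_real (by rw [hr]; linarith)).trans ?_
      rw [hr]
      set n := ⌈s.re/2⌉₊
      have g1 : s.re/2 ≤ n := Nat.le_ceil _
      have g2 : (n:ℝ) < s.re/2 + 1 := Nat.ceil_lt_add_one (by linarith)
      calc Real.Gamma (s.re/2) ≤ Real.Gamma (n+1) := 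
            Real.Gamma_strictMonoOn_Ici.monotoneOn (by simp; linarith) (by simp; linarith) (by linarith)
        _ = (n.factorial : ℝ) := Real.Gamma_nat_eq_factorial n
        _ ≤ (n:ℝ)^n := by exact_mod_cast Nat.factorial_le_pow n
        _ = (n:ℝ)^(n:ℝ) := (Real.rpow_natCast _ _).symm
        _ ≤ (‖s‖ + 1) ^ (n:ℝ) := by gcongr; linarith
        _ ≤ _ := Real.rpow_le_rpow_of_exponent_le (by linarith) (by linarith)
    calc _ ≤ 1 * (‖s‖ + 1) ^ (‖s‖ + 1) := by gcongr
      _ = _ := one_mul _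
  rw [e1]
  calc _ ≤ ‖riemannZeta s * s.Gammaℝ‖ + ‖1/s‖ + ‖1/(1-s)‖ := norm_add₃_le
    _ ≤ B2 * (‖s‖ + 1) ^ (‖s‖ + 1) + 1 + 1 := by
      rw [norm_mul]; gcongr; exact h2 s (by linarith)
    _ ≤ _ := by nlinarith

/-- Entire function whose zeros include the nontrivial zeros. -/
noncomputable def xiG (s : ℂ) : ℂ := s * (1 - s) * completedRiemannZeta₀ s - 1

lemma xiG_bound : ∃ B, 1 ≤ B ∧ ∀ s : ℂ, ‖xiG s‖ ≤ B * (‖s‖ + 2) ^ (‖s‖ + 4) := by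
  obtain ⟨B, hB, h⟩ := xi0_right_bound
  refine ⟨B + 1, by linarith, fun s => ?_⟩
  have hx : ‖completedRiemannZeta₀ s‖ ≤ B * (‖s‖ + 2) ^ (‖s‖ + 2) := by
    rcases le_total (1/2) s.re with hs | hs
    · refine (h s hs).trans ?_
      gcongr ?_ * ?_
      calc (‖s‖ + 1) ^ (‖s‖ + 1) ≤ (‖s‖ + 2) ^ (‖s‖ + 1) := by gcongr; norm_num
        _ ≤ _ := Real.rpow_le_rpow_of_exponent_le (by linarith [norm_nonneg s]) (by linarith)
    · rw [← completedRiemannZeta₀_one_sub]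
      refine (h (1-s) (by simp; linarith)).trans ?_
      have : ‖1 - s‖ ≤ ‖s‖ + 1 := by
        calc _ ≤ ‖(1:ℂ)‖ + ‖s‖ := norm_sub_le _ _
          _ = _ := by rw [norm_one, add_comm]
      gcongr ?_ * ?_
      calc (‖1-s‖ + 1) ^ (‖1-s‖ + 1) ≤ (‖s‖ + 2) ^ (‖1-s‖ + 1) := by gcongr ?_ ^ _; linarith
        _ ≤ _ := Real.rpow_le_rpow_of_exponent_le (by linarith [norm_nonneg s]) (by linarith)
  have hone : 1 ≤ (‖s‖ + 2) ^ (‖s‖ + 4) := Real.one_le_rpow (by linarith [norm_nonneg s]) (by positivity)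
  have h2 : (‖s‖ + 2) ^ (‖s‖ + 4) = (‖s‖ + 2) ^ (‖s‖ + 2) * (‖s‖+2)^2 := by
    rw [← Real.rpow_natCast, ← Real.rpow_add (by positivity)]
    congr 1; push_cast; ring
  have h3 : ‖s * (1 - s)‖ ≤ (‖s‖+2)^2 := by
    rw [norm_mul]
    have : ‖1 - s‖ ≤ ‖s‖ + 1 := by
        calc _ ≤ ‖(1:ℂ)‖ + ‖s‖ := norm_sub_le _ _
          _ = _ := by rw [norm_one, add_comm]
    nlinarith [norm_nonneg s, norm_nonneg (1-s)]
  unfold xiG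
  calc _ ≤ ‖s * (1 - s) * completedRiemannZeta₀ s‖ + ‖(1:ℂ)‖ := norm_sub_le _ _
    _ ≤ (‖s‖+2)^2 * (B * (‖s‖ + 2) ^ (‖s‖ + 2)) + 1 := by
      rw [norm_mul, norm_one]; gcongr
    _ = B * (‖s‖ + 2) ^ (‖s‖ + 4) + 1 := by rw [h2]; ring
    _ ≤ _ := by linarith

lemma xiG_zero : xiG 0 = -1 := by simp [xiG]

lemma xiG_differentiable : Differentiable ℂ xiG := by
  unfold xiG
  have := differentiable_completedZeta₀
  fun_prop

lemma xiG_eq_zero {s : ℂ} (h : riemannZeta s = 0) (h0 : 0 < s.re) (h1 : s.re < 1) : xiG s = 0 := by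
  have hs0 : s ≠ 0 := by rintro rfl; norm_num at h0
  have hs1 : 1 - s ≠ 0 := by
    intro h0
    have := congrArg Complex.re h0
    simp at this; linarith
  have hG : s.Gammaℝ ≠ 0 := Complex.Gammaℝ_ne_zero_of_re_pos h0
  rw [riemannZeta_def_of_ne_zero hs0, div_eq_zero_iff, or_iff_left hG, completedRiemannZeta_eq] at h
  have : completedRiemannZeta₀ s = 1/s + 1/(1-s) := by linear_combination h
  unfold xiG
  rw [this]; field_simp; ring

lemma xiG_card (b : ℝ) (hb : 1 < b) : ∃ K, 0 ≤ K ∧ ∀ R : ℝ, 1 ≤ R → ∀ F : Finset ℂ,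
    (∀ z ∈ F, xiG z = 0 ∧ ‖z‖ ≤ R) → (F.card : ℝ) ≤ K * R ^ b := by
  obtain ⟨B, hB, hbd⟩ := xiG_bound
  set ε := b - 1 with hε
  have hε0 : 0 < ε := by linarith
  have hl2 : 0 < Real.log 2 := Real.log_pos (by norm_num)
  have hlB : 0 ≤ Real.log B := Real.log_nonneg hB
  refine ⟨(Real.log B + 6 * (4 ^ ε / ε)) / Real.log 2, by positivity, fun R hR F hF => ?_⟩
  have han : AnalyticOnNhd ℂ xiG Set.univ := fun z _ => xiG_differentiable.analyticAt z
  have hord : ∀ z, analyticOrderAt xiG z ≠ ⊤ := by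
    intro z h
    rw [analyticOrderAt_eq_top] at h
    have := han.eqOn_zero_of_preconnected_of_eventuallyEq_zero isPreconnected_univ (mem_univ z) h
      (mem_univ 0)
    rw [xiG_zero] at this
    norm_num at this
  have hR' : |R| = R := abs_of_pos (by linarith)
  have h2R' : |2 * R| = 2 * R := abs_of_pos (by linarith)
  have hM : 1 ≤ B * (2 * R + 2) ^ (2 * R + 4) := by
    have : 1 ≤ (2 * R + 2) ^ (2 * R + 4) := Real.one_le_rpow (by linarith) (by linarith)
    nlinarith
  have hJ := AnalyticOnNhd.sum_divisor_le (c := 0) (r := R) (R := 2 * R)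
    (M := B * (2 * R + 2) ^ (2 * R + 4)) (f := xiG) (by rw [hR']; linarith)
    (by rw [hR', h2R']; linarith) hM (han.mono (subset_univ _)) (by rw [xiG_zero]; norm_num)
    (by
      intro z hz
      rw [h2R', mem_sphere_zero_iff_norm] at hz
      have := hbd z
      rwa [hz] at this)
  rw [hR', xiG_zero, norm_neg, norm_one, div_one, mul_div_assoc, div_self (by linarith : R ≠ 0), mul_one] at hJ
  have hanR : AnalyticOnNhd ℂ xiG (Metric.closedBall 0 R) := han.mono (subset_univ _)
  have hnn := MeromorphicOn.AnalyticOnNhd.divisor_nonneg hanR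
  have hfin := (MeromorphicOn.divisor xiG (Metric.closedBall 0 R)).finiteSupport (isCompact_closedBall 0 R)
  have hcard : (F.card : ℤ) ≤ ∑ᶠ u, MeromorphicOn.divisor xiG (Metric.closedBall 0 R) u := by
    rw [finsum_eq_sum_of_support_subset (s := hfin.toFinset ∪ F) _ (by simp)]
    calc (F.card : ℤ) = ∑ u ∈ F, (1:ℤ) := by simp
      _ ≤ ∑ u ∈ F, MeromorphicOn.divisor xiG (Metric.closedBall 0 R) u := by
        refine Finset.sum_le_sum fun u hu => ?_
        obtain ⟨h0, hn⟩ := hF u hu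
        rw [MeromorphicOn.AnalyticOnNhd.divisor_apply hanR (by simpa using hn)]
        have hne : analyticOrderAt xiG u ≠ 0 := by
          rw [(han u (mem_univ u)).analyticOrderAt_ne_zero]; exact h0
        obtain ⟨n, hn⟩ := ENat.ne_top_iff_exists.1 (hord u)
        rw [← hn] at hne ⊢
        simp at hne ⊢
        omega
      _ ≤ _ := Finset.sum_le_sum_of_subset_of_nonneg Finset.subset_union_right
        (fun i _ _ => hnn i)
  have hcard' : (F.card : ℝ) ≤ ((∑ᶠ u, MeromorphicOn.divisor xiG (Metric.closedBall 0 R) u : ℤ) : ℝ) := by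
    exact_mod_cast hcard
  refine (hcard'.trans hJ).trans ?_
  rw [div_mul_eq_mul_div]
  gcongr
  rw [Real.log_mul (by linarith) (by positivity), Real.log_rpow (by linarith)]
  have hRb : R ^ b = R * R ^ ε := by
    rw [hε, Real.rpow_sub (by linarith), Real.rpow_one]; field_simp
  have hRε : 1 ≤ R ^ ε := Real.one_le_rpow hR hε0.le
  have h1 : Real.log (2 * R + 2) ≤ 4 ^ ε * R ^ ε / ε := by
    rw [← Real.mul_rpow (by norm_num) (by linarith)]
    refine (Real.log_le_log (by linarith) (by linarith : 2 * R + 2 ≤ 4 * R)).trans ?_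
    exact Real.log_le_rpow_div (by linarith) hε0
  have h2 : (2 * R + 4) * Real.log (2 * R + 2) ≤ (6 * R) * (4 ^ ε * R ^ ε / ε) := by
    have := Real.log_nonneg (by linarith : 1 ≤ 2 * R + 2)
    gcongr
    linarith
  have h3 : 1 ≤ R ^ b := Real.one_le_rpow hR (by linarith)
  have h4 : (6 * R) * (4 ^ ε * R ^ ε / ε) = 6 * (4 ^ ε / ε) * R ^ b := by rw [hRb]; ring
  nlinarith

lemma summable_of_card {α : Type*} (w : α → ℝ) (hw : ∀ x, 1 ≤ w x) (K b a : ℝ) (hK : 0 ≤ K)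
    (hab : b < a) (ha : 0 ≤ a) (hcard : ∀ R : ℝ, 1 ≤ R → ∀ F : Finset α,
    (∀ z ∈ F, w z ≤ R) → (F.card : ℝ) ≤ K * R ^ b) : Summable (fun x => w x ^ (-a)) := by
  have hj : ∀ x, ∃ j : ℕ, (2:ℝ) ^ j ≤ w x ∧ w x < 2 ^ (j+1) := fun x =>
    exists_nat_pow_near (hw x) (by norm_num)
  choose j hj1 hj2 using hj
  set q : ℝ := 2 ^ (b - a) with hq
  have hq0 : 0 < q := by positivity
  have hq1 : q < 1 := Real.rpow_lt_one_of_one_lt_of_neg (by norm_num) (by linarith)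
  have hgeo : Summable (fun n : ℕ => K * 2 ^ b * q ^ n) :=
    (summable_geometric_of_lt_one hq0.le hq1).mul_left _
  refine summable_of_sum_le (c := ∑' n : ℕ, K * 2 ^ b * q ^ n)
    (fun x => Real.rpow_nonneg (by linarith [hw x]) _) fun F => ?_
  classical
  rw [← Finset.sum_fiberwise_of_maps_to (t := F.image j) (g := j)
    (fun x hx => Finset.mem_image_of_mem j hx)]
  refine le_trans (Finset.sum_le_sum fun n _ => ?_)
    (hgeo.sum_le_tsum (F.image j) (fun n _ => by positivity))
  have h1 : ∀ x ∈ F.filter (fun x => j x = n), w x ^ (-a) ≤ ((2:ℝ) ^ n) ^ (-a) := by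
    intro x hx
    have hx' : j x = n := (Finset.mem_filter.1 hx).2
    apply Real.rpow_le_rpow_of_nonpos (by positivity) (by rw [← hx']; exact hj1 x) (by linarith)
  refine (Finset.sum_le_card_nsmul _ _ _ h1).trans ?_
  rw [nsmul_eq_mul]
  have h2 := hcard (2 ^ (n+1)) (one_le_pow₀ (by norm_num)) (F.filter (fun x => j x = n)) (by
    intro x hx
    have hx' : j x = n := (Finset.mem_filter.1 hx).2
    rw [← hx']; exact (hj2 x).le)
  calc _ ≤ K * (2 ^ (n+1)) ^ b * ((2:ℝ) ^ n) ^ (-a) := by gcongr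
    _ = K * 2 ^ b * q ^ n := by
      rw [pow_succ, Real.mul_rpow (by positivity) (by norm_num), hq, ← Real.rpow_natCast, ← Real.rpow_natCast,
        ← Real.rpow_mul (by norm_num), ← Real.rpow_mul (by norm_num), ← Real.rpow_mul (by norm_num)]
      have : (2:ℝ) ^ ((b - a) * n) = 2 ^ ((n:ℝ) * b) * 2 ^ ((n:ℝ) * -a) := by
        rw [← Real.rpow_add (by norm_num)]; congr 1; ring
      rw [this]; ring

/-- Nontrivial zeros. -/
abbrev ZZ := {ρ : ℂ // riemannZeta ρ = 0 ∧ 0 < ρ.re ∧ ρ.re < 1}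

lemma zeros_summable (a : ℝ) (ha : 1 < a) : Summable (fun ρ : ZZ => (1 + |(ρ:ℂ).im|) ^ (-a)) := by
  obtain ⟨K, hK, h⟩ := xiG_card ((1 + a)/2) (by linarith)
  refine summable_of_card (fun ρ : ZZ => 1 + |(ρ:ℂ).im|) (fun x => by linarith [abs_nonneg (x:ℂ).im])
    K ((1+a)/2) a hK (by linarith) (by linarith) fun R hR F hF => ?_
  have := h R hR (F.map (Function.Embedding.subtype _)) (by
    intro z hz
    obtain ⟨ρ, hρ, rfl⟩ := Finset.mem_map.1 hz
    obtain ⟨h0, h1, h2⟩ := ρ.2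
    refine ⟨xiG_eq_zero h0 h1 h2, ?_⟩
    have := hF ρ hρ
    have h3 := Complex.norm_le_abs_re_add_abs_im (ρ:ℂ)
    rw [abs_of_pos h1] at h3
    simp only [Function.Embedding.subtype_apply]
    linarith)
  simpa using this

lemma arg_mul_im_bounds {s : ℂ} (hs : 0 < s.re) :
    Real.pi / 2 * |s.im| - s.re ≤ s.arg * s.im ∧ s.arg * s.im ≤ Real.pi / 2 * |s.im| := by
  have hle : |s.arg| ≤ Real.pi / 2 := Complex.abs_arg_le_pi_div_two_iff.2 hs.le
  have hlt : |s.arg| < Real.pi / 2 := Complex.abs_arg_lt_pi_div_two_iff.2 (Or.inl hs)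
  have hprod : s.arg * s.im = |s.arg| * |s.im| := by
    rcases le_or_gt 0 s.im with h | h
    · rw [abs_of_nonneg h, abs_of_nonneg (Complex.arg_nonneg_iff.2 h)]
    · rw [abs_of_neg h, abs_of_neg (Complex.arg_neg_iff.2 h)]; ring
  rw [hprod]
  refine ⟨?_, by gcongr⟩
  have htan : Real.tan s.arg = s.im / s.re := Complex.tan_arg s
  have htan' : Real.tan |s.arg| = |s.im| / s.re := by
    rcases le_or_gt 0 s.im with h | h
    · rw [abs_of_nonneg h, abs_of_nonneg (Complex.arg_nonneg_iff.2 h), htan]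
    · rw [abs_of_neg h, abs_of_neg (Complex.arg_neg_iff.2 h), Real.tan_neg, htan]; ring
  rcases eq_or_ne s.im 0 with h0 | h0
  · simp [h0]; exact hs.le
  have hi : 0 < |s.im| := abs_pos.2 h0
  have h1 : Real.pi / 2 - |s.arg| < Real.tan (Real.pi / 2 - |s.arg|) := by
    apply Real.lt_tan (by linarith)
    have : 0 < |s.arg| := by
      apply abs_pos.2
      intro h
      rw [h] at htan
      rw [Real.tan_zero] at htan
      have h5 : s.im = 0 ∨ s.re = 0 := by
        have := htan.symm
        rwa [div_eq_zero_iff] at this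
      rcases h5 with h | h
      · exact h0 h
      · linarith
    linarith
  rw [Real.tan_pi_div_two_sub, htan', inv_div, lt_div_iff₀ hi] at h1
  linarith

lemma norm_sin_le (z : ℂ) : ‖Complex.sin z‖ ≤ Real.exp |z.im| := by
  rw [Complex.sin]
  have h1 : ‖Complex.exp (-z * I)‖ ≤ Real.exp |z.im| := by
    rw [Complex.norm_exp]; apply Real.exp_le_exp.2; simp [le_abs_self]
  have h2 : ‖Complex.exp (z * I)‖ ≤ Real.exp |z.im| := by
    rw [Complex.norm_exp]; apply Real.exp_le_exp.2; simp [neg_le_abs]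
  have h3 := norm_sub_le (Complex.exp (-z * I)) (Complex.exp (z * I))
  rw [norm_div, norm_mul, norm_I, mul_one, RCLike.norm_ofNat]
  linarith

lemma norm_Gamma_half_sq {s : ℂ} (hs : s.re = 1/2) :
    ‖Complex.Gamma s‖ ^ 2 = Real.pi / Real.cosh (Real.pi * s.im) := by
  have h := Complex.Gamma_mul_Gamma_one_sub s
  have h1 : 1 - s = (starRingEnd ℂ) s := by
    apply Complex.ext
    · simp [hs]; norm_num
    · simp
  have h2 : Complex.sin (Real.pi * s) = ((Real.cosh (Real.pi * s.im) : ℝ) : ℂ) := by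
    have : (Real.pi : ℂ) * s = Real.pi / 2 - (-((Real.pi * s.im : ℝ) : ℂ) * I) := by
      apply Complex.ext
      · simp [hs]; ring
      · simp
    rw [this, Complex.sin_pi_div_two_sub, Complex.cos_mul_I, Complex.cosh_neg, Complex.ofReal_cosh]
  rw [h1, Complex.Gamma_conj, Complex.mul_conj, h2, Complex.normSq_eq_norm_sq] at h
  exact_mod_cast h

lemma norm_Gamma_half_le {s : ℂ} (hs : s.re = 1/2) :
    ‖Complex.Gamma s‖ ≤ 3 * Real.exp (-(Real.pi / 2 * |s.im|)) := by
  apply le_of_sq_le_sq _ (by positivity)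
  rw [norm_Gamma_half_sq hs, div_le_iff₀ (Real.cosh_pos _), mul_pow, ← Real.exp_nat_mul]
  have : Real.cosh (Real.pi * s.im) ≥ Real.exp (Real.pi * |s.im|) / 2 := by
    rw [← Real.cosh_abs, abs_mul, abs_of_pos Real.pi_pos, Real.cosh_eq]
    have := Real.exp_pos (-(Real.pi * |s.im|))
    linarith
  have h2 : Real.exp ((2:ℕ) * -(Real.pi / 2 * |s.im|)) * Real.exp (Real.pi * |s.im|) = 1 := by
    rw [← Real.exp_add, Real.exp_eq_one_iff]; push_cast; ring
  have h3 := Real.exp_pos ((2:ℕ) * -(Real.pi / 2 * |s.im|))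
  have := Real.pi_lt_four
  nlinarith

lemma norm_bounds {s : ℂ} (hs : 1/2 ≤ s.re) : (1 + |s.im|) / 3 ≤ ‖s‖ := by
  have h1 := Complex.abs_im_le_norm s
  have h2 := Complex.re_le_norm s
  linarith

/-- The comparison function in the Stirling formula. -/
noncomputable def stF (s : ℂ) : ℂ := Complex.Gamma s * s ^ (1/2 - s)

lemma norm_stF {s : ℂ} (hs : s ≠ 0) :
    ‖stF s‖ = ‖Complex.Gamma s‖ * ‖s‖ ^ (1/2 - s.re) * Real.exp (s.arg * s.im) := by
  rw [stF, norm_mul, Complex.norm_cpow_of_ne_zero hs]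
  have h1 : (1/2 - s).re = 1/2 - s.re := by simp
  have h2 : (1/2 - s).im = - s.im := by simp
  rw [h1, h2, mul_neg, Real.exp_neg, div_inv_eq_mul, mul_assoc]

lemma stF_half {s : ℂ} (hs : s.re = 1/2) : ‖stF s‖ ≤ 3 := by
  have h0 : s ≠ 0 := by rintro rfl; norm_num at hs
  rw [norm_stF h0, hs, sub_self, Real.rpow_zero, mul_one]
  calc _ ≤ 3 * Real.exp (-(Real.pi / 2 * |s.im|)) * Real.exp (Real.pi / 2 * |s.im|) := by
        gcongr ?_ * ?_
        · exact norm_Gamma_half_le hs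
        · exact Real.exp_le_exp.2 (arg_mul_im_bounds (by rw [hs]; norm_num)).2
    _ = 3 := by rw [mul_assoc, ← Real.exp_add]; simp

lemma stF_three_half {s : ℂ} (hs : s.re = 3/2) : ‖stF s‖ ≤ 3 := by
  have h0 : s ≠ 0 := by rintro rfl; norm_num at hs
  have h1 : s - 1 ≠ 0 := by
    intro h
    have := congrArg Complex.re h
    norm_num [hs] at this
  have hr : (s-1).re = 1/2 := by simp [hs]; norm_num
  have hG : Complex.Gamma s = (s - 1) * Complex.Gamma (s-1) := by
    rw [← Complex.Gamma_add_one _ h1, sub_add_cancel]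
  have hn : ‖s - 1‖ ≤ ‖s‖ := by
    rw [Complex.norm_def, Complex.norm_def]
    apply Real.sqrt_le_sqrt
    rw [Complex.normSq_apply, Complex.normSq_apply, hr, hs]
    simp; norm_num
  have hp : 0 < ‖s‖ := norm_pos_iff.2 h0
  rw [norm_stF h0, hs, hG, norm_mul, show (1/2 - 3/2 : ℝ) = -1 by norm_num, Real.rpow_neg_one]
  calc _ ≤ ‖s‖ * (3 * Real.exp (-(Real.pi / 2 * |s.im|))) * ‖s‖⁻¹ * Real.exp (Real.pi / 2 * |s.im|) := by
        gcongr ?_ * ?_ * _ * ?_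
        · have := norm_Gamma_half_le hr
          simpa using this
        · exact Real.exp_le_exp.2 (arg_mul_im_bounds (by rw [hs]; norm_num)).2
    _ = 3 * (Real.exp (-(Real.pi / 2 * |s.im|)) * Real.exp (Real.pi / 2 * |s.im|)) := by field_simp
    _ = 3 := by rw [← Real.exp_add]; simp

lemma realGamma_bound (a b : ℝ) (ha : 0 < a) : ∃ B, 0 ≤ B ∧ ∀ x, a ≤ x → x ≤ b → Real.Gamma x ≤ B := by
  have hc : ContinuousOn Real.Gamma (Icc a b) := by
    intro x hx
    apply ContinuousAt.continuousWithinAt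
    refine (Real.differentiableAt_Gamma fun m => ?_).continuousAt
    have := hx.1
    have : (0:ℝ) ≤ m := Nat.cast_nonneg m
    intro h; linarith
  obtain ⟨B, hB⟩ := isCompact_Icc.exists_bound_of_continuousOn hc
  exact ⟨max B 0, le_max_right _ _, fun x h1 h2 => (le_abs_self _).trans ((hB x ⟨h1, h2⟩).trans (le_max_left _ _))⟩

lemma stF_bound {s : ℂ} (h1 : 1/2 ≤ s.re) (h2 : s.re ≤ 3/2) : ‖stF s‖ ≤ 3 := by
  refine PhragmenLindelof.vertical_strip (a := 1/2) (b := 3/2) (f := stF) ?_ ?_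
    (fun z hz => stF_half hz) (fun z hz => stF_three_half hz) h1 h2
  · apply DifferentiableOn.diffContOnCl
    have hcl : closure (Complex.re ⁻¹' Ioo (1/2:ℝ) (3/2)) ⊆ {z : ℂ | 1/2 ≤ z.re} :=
      closure_minimal (fun z hz => hz.1.le) (isClosed_le continuous_const Complex.continuous_re)
    intro z hz
    have hz' : 1/2 ≤ z.re := hcl hz
    apply DifferentiableAt.differentiableWithinAt
    unfold stF
    have hG : DifferentiableAt ℂ Complex.Gamma z := by
      refine Complex.differentiableAt_Gamma _ fun m h => ?_
      have := congrArg Complex.re h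
      have h0 : (0:ℝ) ≤ m := Nat.cast_nonneg m
      simp at this; linarith
    refine hG.mul (DifferentiableAt.cpow (by fun_prop) (by fun_prop) ?_)
    exact Or.inl (by linarith)
  · obtain ⟨B, hB0, hB⟩ := realGamma_bound (1/2) (3/2) (by norm_num)
    refine ⟨1, ?_, Real.pi / 2, ?_⟩
    · have := Real.pi_gt_three
      norm_num; linarith
    · refine Asymptotics.IsBigO.of_bound (B * 3) ?_
      refine Filter.mem_inf_of_right ?_
      rw [Filter.mem_principal]
      intro z hz
      have hz1 : 1/2 ≤ z.re := hz.1.le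
      have hz2 : z.re ≤ 3/2 := hz.2.le
      have h0 : z ≠ 0 := by rintro rfl; norm_num at hz1
      show ‖stF z‖ ≤ _
      rw [norm_stF h0, Real.norm_of_nonneg (Real.exp_pos _).le]
      gcongr ?_ * ?_ * ?_
      · exact (norm_Gamma_le_real (by linarith)).trans (hB _ hz1 hz2)
      · have h3 := norm_bounds hz1
        have h4 : (1/3:ℝ) ≤ ‖z‖ := by linarith [abs_nonneg z.im]
        calc ‖z‖ ^ (1/2 - z.re) ≤ (1/3) ^ (1/2 - z.re) :=
              Real.rpow_le_rpow_of_nonpos (by norm_num) h4 (by linarith)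
          _ ≤ (1/3) ^ (-1:ℝ) := Real.rpow_le_rpow_of_exponent_ge (by norm_num) (by norm_num) (by linarith)
          _ = 3 := by rw [Real.rpow_neg_one]; norm_num
      · refine Real.exp_le_exp.2 ((arg_mul_im_bounds (by linarith)).2.trans ?_)
        gcongr
        rw [one_mul]
        linarith [Real.add_one_le_exp |z.im|]

lemma Gamma_upper : ∃ C, 0 < C ∧ ∀ s : ℂ, 1/2 ≤ s.re → s.re ≤ 3/2 →
    ‖Complex.Gamma s‖ ≤ C * (1 + |s.im|) ^ (s.re - 1/2) * Real.exp (-(Real.pi / 2 * |s.im|)) := by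
  refine ⟨6 * Real.exp (3/2), by positivity, fun s h1 h2 => ?_⟩
  have h0 : s ≠ 0 := by rintro rfl; norm_num at h1
  have hp : 0 < ‖s‖ := norm_pos_iff.2 h0
  have hb := stF_bound h1 h2
  rw [norm_stF h0] at hb
  have ha := (arg_mul_im_bounds (s := s) (by linarith)).1
  have he : Real.exp (Real.pi / 2 * |s.im|) * Real.exp (-(3/2)) ≤ Real.exp (s.arg * s.im) := by
    rw [← Real.exp_add]; apply Real.exp_le_exp.2; linarith
  have hn : ‖s‖ ≤ 2 * (1 + |s.im|) := by
    have := Complex.norm_le_abs_re_add_abs_im s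
    rw [abs_of_pos (by linarith : 0 < s.re)] at this
    linarith [abs_nonneg s.im]
  have hpow : ‖s‖ ^ (s.re - 1/2) ≤ 2 * (1 + |s.im|) ^ (s.re - 1/2) := by
    calc _ ≤ (2 * (1 + |s.im|)) ^ (s.re - 1/2) := by gcongr
      _ = 2 ^ (s.re - 1/2) * (1 + |s.im|) ^ (s.re - 1/2) := Real.mul_rpow (by norm_num) (by positivity)
      _ ≤ 2 ^ (1:ℝ) * (1 + |s.im|) ^ (s.re - 1/2) := by
        gcongr
        · norm_num
        · linarith
      _ = _ := by rw [Real.rpow_one]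
  have hinv : ‖s‖ ^ (1/2 - s.re) * ‖s‖ ^ (s.re - 1/2) = 1 := by
    rw [← Real.rpow_add hp]; simp
  have hb' : ‖Complex.Gamma s‖ * ‖s‖ ^ (1/2 - s.re) * (Real.exp (Real.pi / 2 * |s.im|) * Real.exp (-(3/2))) ≤ 3 :=
    le_trans (by gcongr) hb
  calc ‖Complex.Gamma s‖ = (‖Complex.Gamma s‖ * ‖s‖ ^ (1/2 - s.re) * (Real.exp (Real.pi / 2 * |s.im|) * Real.exp (-(3/2))))
        * (‖s‖ ^ (s.re - 1/2) * Real.exp (3/2) * Real.exp (-(Real.pi / 2 * |s.im|))) := by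
        rw [Real.exp_neg, Real.exp_neg]
        calc _ = ‖Complex.Gamma s‖ * (‖s‖ ^ (1/2 - s.re) * ‖s‖ ^ (s.re - 1/2)) := by rw [hinv, mul_one]
          _ = _ := by field_simp
    _ ≤ 3 * ((2 * (1 + |s.im|) ^ (s.re - 1/2)) * Real.exp (3/2) * Real.exp (-(Real.pi / 2 * |s.im|))) := by
        gcongr
    _ = _ := by ring

lemma Gamma_lower0 : ∃ c, 0 < c ∧ ∀ s : ℂ, 1/2 ≤ s.re → s.re ≤ 3/2 →
    c * (1 + |s.im|) ^ (s.re - 1/2) * Real.exp (-(Real.pi / 2 * |s.im|)) ≤ ‖Complex.Gamma s‖ := by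
  obtain ⟨C, hC, hU⟩ := Gamma_upper
  -- compact part
  have hcomp : IsCompact (Icc (1/2:ℝ) (3/2) ×ℂ Icc (-1:ℝ) 1) := isCompact_Icc.reProdIm isCompact_Icc
  have hcont : ContinuousOn (fun s : ℂ => ‖Complex.Gamma s‖) (Icc (1/2:ℝ) (3/2) ×ℂ Icc (-1:ℝ) 1) := by
    intro z hz
    have hz1 : 1/2 ≤ z.re := hz.1.1
    refine ContinuousAt.continuousWithinAt (ContinuousAt.norm ?_)
    refine (Complex.differentiableAt_Gamma _ fun m h => ?_).continuousAt
    have := congrArg Complex.re h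
    have h0 : (0:ℝ) ≤ m := Nat.cast_nonneg m
    simp at this; linarith
  obtain ⟨z0, hz0, hmin⟩ := hcomp.exists_isMinOn
    ⟨1, by constructor <;> constructor <;> norm_num⟩ hcont
  have hm : 0 < ‖Complex.Gamma z0‖ := by
    have : 1/2 ≤ z0.re := hz0.1.1
    exact norm_pos_iff.2 (Complex.Gamma_ne_zero_of_re_pos (by linarith))
  set m := ‖Complex.Gamma z0‖
  have hpi := Real.pi_gt_three
  refine ⟨min (m/2) (1/C), lt_min (by positivity) (by positivity), fun s h1 h2 => ?_⟩
  have hX : 1 ≤ 1 + |s.im| := by linarith [abs_nonneg s.im]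
  have hXp : 0 < 1 + |s.im| := by linarith
  rcases le_total |s.im| 1 with ht | ht
  · have hle : m ≤ ‖Complex.Gamma s‖ := hmin (show s ∈ _ from ⟨⟨h1, h2⟩, abs_le.1 ht⟩)
    have e1 : (1 + |s.im|) ^ (s.re - 1/2) ≤ 2 := by
      calc _ ≤ (1 + |s.im|) ^ (1:ℝ) := Real.rpow_le_rpow_of_exponent_le hX (by linarith)
        _ ≤ 2 := by rw [Real.rpow_one]; linarith
    have e2 : Real.exp (-(Real.pi / 2 * |s.im|)) ≤ 1 := Real.exp_le_one_iff.2 (by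
      have := mul_nonneg Real.pi_pos.le (abs_nonneg s.im); linarith)
    calc _ ≤ m/2 * 2 * 1 := by
          gcongr
          exact min_le_left _ _
      _ = m := by ring
      _ ≤ _ := hle
  · have hs1 : 1 - s ≠ 0 := by
      intro h
      have := congrArg Complex.im h
      simp at this; rw [this] at ht; norm_num at ht
    have hrefl := Complex.Gamma_mul_Gamma_one_sub s
    have hG2 : Complex.Gamma (2 - s) = (1 - s) * Complex.Gamma (1 - s) := by
      rw [← Complex.Gamma_add_one _ hs1]; congr 1; ring
    have hu := hU (2 - s) (by simp; linarith) (by simp; linarith)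
    have him : |(2 - s).im| = |s.im| := by simp
    have hre : (2 - s).re - 1/2 = 1 - (s.re - 1/2) := by simp; ring
    rw [him, hre, Real.rpow_sub hXp, Real.rpow_one] at hu
    have hsin : ‖Complex.sin (Real.pi * s)‖ ≤ Real.exp (Real.pi * |s.im|) := by
      refine (norm_sin_le _).trans (le_of_eq ?_)
      simp [abs_mul, abs_of_pos Real.pi_pos]
    have hsin0 : Complex.sin (Real.pi * s) ≠ 0 := by
      intro h
      rw [h, div_zero, mul_eq_zero] at hrefl
      rcases hrefl with h' | h'
      · exact Complex.Gamma_ne_zero_of_re_pos (by linarith) h'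
      · rw [h', mul_zero] at hG2
        exact Complex.Gamma_ne_zero_of_re_pos (by simp; linarith) hG2
    have hprod : ‖Complex.Gamma s‖ * ‖Complex.Gamma (2 - s)‖ * ‖Complex.sin (Real.pi * s)‖ = Real.pi * ‖1 - s‖ := by
      rw [hG2, ← norm_mul, ← norm_mul]
      have : Complex.Gamma s * ((1 - s) * Complex.Gamma (1 - s)) * Complex.sin (Real.pi * s)
          = Real.pi * (1 - s) := by
        rw [show Complex.Gamma s * ((1 - s) * Complex.Gamma (1 - s)) = (1 - s) * (Complex.Gamma s * Complex.Gamma (1 - s)) by ring, hrefl]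
        rw [mul_assoc, div_mul_cancel₀ _ hsin0, mul_comm]
      rw [this, norm_mul, Complex.norm_real, Real.norm_of_nonneg Real.pi_pos.le]
    have hn : (1 + |s.im|)/2 ≤ ‖1 - s‖ := by
      have := Complex.abs_im_le_norm (1 - s)
      simp at this
      linarith
    set X := 1 + |s.im|
    set P := X ^ (s.re - 1/2) with hP
    have hPp : 0 < P := by positivity
    set e := Real.exp (-(Real.pi / 2 * |s.im|)) with he
    have hep : 0 < e := Real.exp_pos _
    have hee : Real.exp (Real.pi * |s.im|) = 1 / (e * e) := by
      rw [he, ← Real.exp_add, one_div, ← Real.exp_neg]; congr 1; ring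
    rw [hee] at hsin
    have key : Real.pi * (X/2) ≤ ‖Complex.Gamma s‖ * (C * (X / P) * e) * (1 / (e*e)) := by
      calc _ ≤ Real.pi * ‖1 - s‖ := by gcongr
        _ = _ := hprod.symm
        _ ≤ _ := by gcongr
    have key2 : ‖Complex.Gamma s‖ * (C * (X / P) * e) * (1 / (e*e)) = ‖Complex.Gamma s‖ * (C * X / (P * e)) := by
      field_simp
    rw [key2] at key
    have key3 : X ≤ ‖Complex.Gamma s‖ * (C * X / (P * e)) := le_trans (by nlinarith) key
    rw [← mul_div_assoc, le_div_iff₀ (by positivity)] at key3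
    have key4 : P * e ≤ ‖Complex.Gamma s‖ * C := by
      refine le_of_mul_le_mul_left ?_ hXp
      linarith
    calc _ ≤ 1/C * P * e := by
          gcongr
          exact min_le_right _ _
      _ = P * e / C := by ring
      _ ≤ _ := by rw [div_le_iff₀ hC]; exact key4

lemma Gamma_lower (n : ℕ) : ∃ c, 0 < c ∧ ∀ s : ℂ, 1/2 ≤ s.re → s.re ≤ n + 3/2 →
    c * (1 + |s.im|) ^ (s.re - 1/2) * Real.exp (-(Real.pi / 2 * |s.im|)) ≤ ‖Complex.Gamma s‖ := by
  induction n with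
  | zero => simpa using Gamma_lower0
  | succ n ih =>
    obtain ⟨c, hc, h⟩ := ih
    refine ⟨c/3, by positivity, fun s h1 h2 => ?_⟩
    have hXp : 0 < 1 + |s.im| := by linarith [abs_nonneg s.im]
    rcases le_total s.re (n + 3/2) with h3 | h3
    · refine le_trans ?_ (h s h1 h3)
      gcongr
      linarith
    · have hn0 : (0:ℝ) ≤ n := Nat.cast_nonneg n
      push_cast at h2
      have hs1 : s - 1 ≠ 0 := by
        intro h
        have := congrArg Complex.re h
        simp at this; linarith
      have hG : Complex.Gamma s = (s - 1) * Complex.Gamma (s-1) := by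
        rw [← Complex.Gamma_add_one _ hs1, sub_add_cancel]
      have hb := h (s-1) (by simp; linarith) (by simp; linarith)
      have hn := norm_bounds (s := s - 1) (by simp; linarith)
      have him : |(s-1).im| = |s.im| := by simp
      have hre : (s-1).re - 1/2 = (s.re - 1/2) - 1 := by simp; ring
      rw [him] at hn hb
      rw [hre, Real.rpow_sub hXp, Real.rpow_one] at hb
      rw [hG, norm_mul]
      calc _ = (1 + |s.im|)/3 * (c * ((1 + |s.im|) ^ (s.re - 1/2) / (1 + |s.im|)) * Real.exp (-(Real.pi / 2 * |s.im|))) := by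
            field_simp
        _ ≤ _ := by gcongr

lemma zeros_norm_lower : ∃ c, 0 < c ∧ ∀ ρ : ZZ, c ≤ ‖(ρ:ℂ)‖ := by
  have h : ∀ᶠ z in nhds (0:ℂ), xiG z ≠ 0 :=
    xiG_differentiable.continuous.continuousAt.eventually_ne (by rw [xiG_zero]; norm_num)
  obtain ⟨ε, hε, hb⟩ := Metric.eventually_nhds_iff.1 h
  refine ⟨ε, hε, fun ρ => ?_⟩
  by_contra hlt
  push Not at hlt
  exact hb (y := (ρ:ℂ)) (by simpa using hlt) (xiG_eq_zero ρ.2.1 ρ.2.2.1 ρ.2.2.2)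

lemma zeros_Gamma_upper : ∃ C, 0 < C ∧ ∀ ρ : ZZ,
    ‖Complex.Gamma ρ‖ ≤ C * (1 + |(ρ:ℂ).im|) ^ ((ρ:ℂ).re - 1/2) * Real.exp (-(Real.pi / 2 * |(ρ:ℂ).im|)) := by
  obtain ⟨C, hC, hU⟩ := Gamma_upper
  obtain ⟨c, hc, hl⟩ := zeros_norm_lower
  refine ⟨C * (1/c + 1), by positivity, fun ρ => ?_⟩
  have hρ := hl ρ
  obtain ⟨s, h0, h1, h2⟩ := ρ
  simp only at hρ ⊢
  have hXp : 0 < 1 + |s.im| := by linarith [abs_nonneg s.im]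
  have hc1 : 1 ≤ 1/c + 1 := by
    have : 0 < 1/c := by positivity
    linarith
  rcases le_total (1/2) s.re with h | h
  · refine (hU s h (by linarith)).trans ?_
    gcongr
    nlinarith
  · have hs : s ≠ 0 := by rintro rfl; norm_num at h1
    have hsp : 0 < ‖s‖ := norm_pos_iff.2 hs
    have hu := hU (s+1) (by simp; linarith) (by simp; linarith)
    have him : |(s+1).im| = |s.im| := by simp
    have hre : (s+1).re - 1/2 = (s.re - 1/2) + 1 := by simp; ring
    rw [him, hre, Real.rpow_add hXp, Real.rpow_one, Complex.Gamma_add_one _ hs, norm_mul] at hu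
    have hX : 1 + |s.im| ≤ (1/c + 1) * ‖s‖ := by
      have := Complex.abs_im_le_norm s
      have h5 : 1 ≤ 1/c * ‖s‖ := by rw [one_div, inv_mul_eq_div, le_div_iff₀ hc]; linarith
      linarith
    refine le_of_mul_le_mul_left (hu.trans ?_) hsp
    calc _ ≤ C * ((1 + |s.im|) ^ (s.re - 1/2) * ((1/c + 1) * ‖s‖)) * Real.exp (-(Real.pi / 2 * |s.im|)) := by
          gcongr
      _ = _ := by ring

lemma poly_exp_bound (q : ℝ) : ∃ D, 0 < D ∧ ∀ m : ℝ, 0 ≤ m →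
    (1 + 2 * m) ^ q ≤ D * Real.exp (Real.pi * m) := by
  set n := ⌈q⌉₊
  refine ⟨n.factorial * Real.exp 1, by positivity, fun m hm => ?_⟩
  have h1 := Real.pow_div_factorial_le_exp (1 + 2*m) (by linarith) n
  rw [div_le_iff₀ (by positivity)] at h1
  calc (1 + 2 * m) ^ q ≤ (1 + 2 * m) ^ (n:ℝ) :=
        Real.rpow_le_rpow_of_exponent_le (by linarith) (Nat.le_ceil q)
    _ = (1 + 2*m)^n := Real.rpow_natCast _ _
    _ ≤ Real.exp (1 + 2*m) * n.factorial := h1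
    _ = n.factorial * Real.exp 1 * Real.exp (2 * m) := by rw [Real.exp_add]; ring
    _ ≤ _ := by
      gcongr
      linarith [Real.pi_gt_three]

lemma real_bound (k : ℝ) (hk : 1/2 < k) : ∃ D, 0 < D ∧ ∀ x y b b' : ℝ, 0 < b → b < 1 → 0 < b' → b' < 1 →
    (1 + |x|) ^ (b - 1/2) * Real.exp (-(Real.pi / 2 * |x|)) *
    ((1 + |y|) ^ (b' - 1/2) * Real.exp (-(Real.pi / 2 * |y|))) ≤
    D * ((1 + |x|) ^ (-(3/4 + k/2)) * (1 + |y|) ^ (-(3/4 + k/2))) *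
    ((1 + |x + y|) ^ (b + b' + k + 1/2) * Real.exp (-(Real.pi / 2 * |x + y|))) := by
  obtain ⟨D, hD, hDb⟩ := poly_exp_bound (k + 5/2)
  refine ⟨D, hD, fun x y b b' hb hb1 hb' hb1' => ?_⟩
  have hx := abs_nonneg x
  have hy := abs_nonneg y
  have hxy := abs_nonneg (x+y)
  have htri := abs_add_le x y
  obtain ⟨m, hm⟩ : ∃ m, m = (|x| + |y| - |x+y|)/2 := ⟨_, rfl⟩
  have hm0 : 0 ≤ m := by linarith
  set X := 1 + |x|
  set Y := 1 + |y|
  set W := 1 + |x+y|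
  set S := 1 + |x| + |y|
  have hX : 0 < X := by positivity
  have hY : 0 < Y := by positivity
  have hW : 0 < W := by positivity
  have hS : 0 < S := by positivity
  have hSW : S ≤ W * (1 + 2*m) := by
    have : S = W + 2*m := by simp only [S, W, hm]; ring
    rw [this]
    have : 1 ≤ W := by simp only [W]; linarith
    nlinarith
  set p := b + b' + k + 1/2
  have hp : 0 ≤ p := by positivity
  -- main power inequality
  have h1 : S ^ p ≤ W ^ p * (D * Real.exp (Real.pi * m)) := by
    calc S ^ p ≤ (W * (1 + 2*m)) ^ p := by gcongr
      _ = W ^ p * (1 + 2*m) ^ p := Real.mul_rpow hW.le (by linarith)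
      _ ≤ W ^ p * (1 + 2*m) ^ (k + 5/2) := by
        gcongr 
        · linarith
        · simp only [p]; linarith
      _ ≤ _ := by gcongr; exact hDb m hm0
  have hXS : X ≤ S := by simp only [X, S]; linarith
  have hYS : Y ≤ S := by simp only [Y, S]; linarith
  have h2 : X ^ (b + (3/4 + k/2) - 1/2) * Y ^ (b' + (3/4 + k/2) - 1/2) ≤ S ^ p := by
    calc _ ≤ S ^ (b + (3/4 + k/2) - 1/2) * S ^ (b' + (3/4 + k/2) - 1/2) := by
          gcongr <;> linarith
      _ = S ^ p := by rw [← Real.rpow_add hS]; congr 1; simp only [p]; ring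
  have h3 : X ^ (b - 1/2) = X ^ (-(3/4 + k/2)) * X ^ (b + (3/4 + k/2) - 1/2) := by
    rw [← Real.rpow_add hX]; congr 1; ring
  have h4 : Y ^ (b' - 1/2) = Y ^ (-(3/4 + k/2)) * Y ^ (b' + (3/4 + k/2) - 1/2) := by
    rw [← Real.rpow_add hY]; congr 1; ring
  have h5 : Real.exp (Real.pi * m) * (Real.exp (-(Real.pi / 2 * |x|)) * Real.exp (-(Real.pi / 2 * |y|)))
      = Real.exp (-(Real.pi / 2 * |x + y|)) := by
    rw [← Real.exp_add, ← Real.exp_add, hm]; congr 1; ring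
  have h6 := h2.trans h1
  rw [h3, h4, ← h5]
  set A := X ^ (b + (3/4 + k/2) - 1/2)
  set A' := Y ^ (b' + (3/4 + k/2) - 1/2)
  set Q := X ^ (-(3/4 + k/2))
  set Q' := Y ^ (-(3/4 + k/2))
  have hQ : 0 < Q := by positivity
  have hQ' : 0 < Q' := by positivity
  set ex := Real.exp (-(Real.pi / 2 * |x|))
  set ey := Real.exp (-(Real.pi / 2 * |y|))
  calc _ = (Q * Q' * (ex * ey)) * (A * A') := by ring
    _ ≤ (Q * Q' * (ex * ey)) * (W ^ p * (D * Real.exp (Real.pi * m))) := by gcongr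
    _ = _ := by ring

lemma main_summable (N : ℕ) (hN : 4 ≤ N) (k : ℝ) (hk : 1 / 2 < k) :
    Summable (fun p : ZZ × ZZ =>
      ‖Complex.Gamma p.1 * Complex.Gamma p.2 * (N : ℂ) ^ ((p.1 : ℂ) + p.2) /
        Complex.Gamma ((p.1 : ℂ) + p.2 + k + 1)‖) := by
  obtain ⟨C, hC, hU⟩ := zeros_Gamma_upper
  obtain ⟨c, hc, hL⟩ := Gamma_lower ⌈k + 2⌉₊
  obtain ⟨D, hD, hB⟩ := real_bound k hk
  have hz := zeros_summable (3/4 + k/2) (by linarith)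
  have hprod := (hz.mul_of_nonneg hz (fun _ => by positivity) (fun _ => by positivity)).mul_left
    (C * C * D / c * (N:ℝ)^(2:ℝ))
  refine Summable.of_nonneg_of_le (fun _ => norm_nonneg _) (fun p => ?_) hprod
  obtain ⟨ρ, ρ'⟩ := p
  have hb := hB (ρ:ℂ).im (ρ':ℂ).im (ρ:ℂ).re (ρ':ℂ).re ρ.2.2.1 ρ.2.2.2 ρ'.2.2.1 ρ'.2.2.2
  have u1 := hU ρ
  have u2 := hU ρ'
  have r1 := ρ.2.2
  have r2 := ρ'.2.2
  have hre : ((ρ : ℂ) + ρ' + k + 1).re = (ρ:ℂ).re + (ρ':ℂ).re + k + 1 := by simp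
  have him : ((ρ : ℂ) + ρ' + k + 1).im = (ρ:ℂ).im + (ρ':ℂ).im := by simp
  have hl := hL ((ρ : ℂ) + ρ' + k + 1) (by rw [hre]; linarith) (by
    rw [hre]; linarith [Nat.le_ceil (k+2)])
  rw [hre, him, show (ρ:ℂ).re + (ρ':ℂ).re + k + 1 - 1/2 = (ρ:ℂ).re + (ρ':ℂ).re + k + 1/2 by ring] at hl
  simp only [norm_div, norm_mul]
  have hN1 : (1:ℝ) ≤ N := by exact_mod_cast (by omega : 1 ≤ N)
  have hNn : ‖(N:ℂ) ^ ((ρ:ℂ) + ρ')‖ ≤ (N:ℝ) ^ (2:ℝ) := by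
    rw [Complex.norm_natCast_cpow_of_pos (by omega)]
    apply Real.rpow_le_rpow_of_exponent_le hN1
    simp; linarith
  set Gd := ‖Complex.Gamma ((ρ : ℂ) + ρ' + k + 1)‖
  have hGd : 0 < Gd := norm_pos_iff.2 (Complex.Gamma_ne_zero_of_re_pos (by rw [hre]; linarith))
  rw [div_le_iff₀ hGd]
  set e1 := Real.exp (-(Real.pi / 2 * |(ρ:ℂ).im|))
  set e2 := Real.exp (-(Real.pi / 2 * |(ρ':ℂ).im|))
  set e3 := Real.exp (-(Real.pi / 2 * |(ρ:ℂ).im + (ρ':ℂ).im|))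
  set W := (1 + |(ρ:ℂ).im + (ρ':ℂ).im|) ^ ((ρ:ℂ).re + (ρ':ℂ).re + k + 1/2)
  set P1 := (1 + |(ρ:ℂ).im|) ^ ((ρ:ℂ).re - 1/2)
  set P2 := (1 + |(ρ':ℂ).im|) ^ ((ρ':ℂ).re - 1/2)
  set Q1 := (1 + |(ρ:ℂ).im|) ^ (-(3/4 + k/2))
  set Q2 := (1 + |(ρ':ℂ).im|) ^ (-(3/4 + k/2))
  have hQ1 : 0 ≤ Q1 := by positivity
  have hQ2 : 0 ≤ Q2 := by positivity
  have hP1 : 0 ≤ P1 := by positivity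
  have hP2 : 0 ≤ P2 := by positivity
  have he1 : 0 ≤ e1 := (Real.exp_pos _).le
  have he2 : 0 ≤ e2 := (Real.exp_pos _).le
  have hWe : W * e3 ≤ Gd / c := by rw [le_div_iff₀ hc]; linarith
  calc ‖Complex.Gamma ρ‖ * ‖Complex.Gamma ρ'‖ * ‖(N:ℂ) ^ ((ρ:ℂ) + ρ')‖
      ≤ (C * P1 * e1) * (C * P2 * e2) * (N:ℝ)^(2:ℝ) := by gcongr
    _ = C * C * (N:ℝ)^(2:ℝ) * (P1 * e1 * (P2 * e2)) := by ring
    _ ≤ C * C * (N:ℝ)^(2:ℝ) * (D * (Q1 * Q2) * (W * e3)) := by gcongr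
    _ ≤ C * C * (N:ℝ)^(2:ℝ) * (D * (Q1 * Q2) * (Gd / c)) := by gcongr
    _ = _ := by ring



end

theorem stmt_18 (N : ℕ) (hN : 4 ≤ N) (k : ℝ) (hk : 1 / 2 < k) :
    Summable (fun p : {ρ : ℂ // riemannZeta ρ = 0 ∧ 0 < ρ.re ∧ ρ.re < 1} ×
        {ρ : ℂ // riemannZeta ρ = 0 ∧ 0 < ρ.re ∧ ρ.re < 1} =>
      ‖Complex.Gamma p.1 * Complex.Gamma p.2 * (N : ℂ) ^ ((p.1 : ℂ) + p.2) /
        Complex.Gamma ((p.1 : ℂ) + p.2 + k + 1)‖) ∧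
    ∑' p : {ρ : ℂ // riemannZeta ρ = 0 ∧ 0 < ρ.re ∧ ρ.re < 1} ×
        {ρ : ℂ // riemannZeta ρ = 0 ∧ 0 < ρ.re ∧ ρ.re < 1},
      Complex.Gamma p.1 * Complex.Gamma p.2 * (N : ℂ) ^ ((p.1 : ℂ) + p.2) /
        Complex.Gamma ((p.1 : ℂ) + p.2 + k + 1) =
    ∑' ρ : {ρ : ℂ // riemannZeta ρ = 0 ∧ 0 < ρ.re ∧ ρ.re < 1},
      Complex.Gamma ρ *
        (∑' ρ' : {ρ : ℂ // riemannZeta ρ = 0 ∧ 0 < ρ.re ∧ ρ.re < 1},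
          Complex.Gamma ρ' * (N : ℂ) ^ (ρ' : ℂ) /
            Complex.Gamma ((ρ' : ℂ) + ((ρ : ℂ) + k) + 1)) *
        (N : ℂ) ^ (ρ : ℂ) := by

  have hs := main_summable N hN k hk
  refine ⟨hs, ?_⟩
  have hs' := hs.of_norm
  rw [hs'.tsum_prod]
  refine tsum_congr fun ρ => ?_
  rw [← tsum_mul_left, ← tsum_mul_right]
  refine tsum_congr fun ρ' => ?_
  have hN0 : (N : ℂ) ≠ 0 := by exact_mod_cast (by omega : N ≠ 0)
  rw [Complex.cpow_add _ _ hN0, show (ρ' : ℂ) + ((ρ : ℂ) + k) + 1 = (ρ : ℂ) + ρ' + k + 1 by ring]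
  ring
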